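/- Let M be a symmetric n×n matrix over GF(2), let ρ be a row vector of length n with transpose κ, and let M₁ = [[M, κ],[ρ, 1]], M₂ = [[M, κ],[ρ, 0]], M₃ = [[M, 0],[0, 1]]. Suppose ρ lies in the row space of M. Then one of M₁, M₂ has rank equal to rank(M) and the other has rank equal to rank(M) + 1 = rank(M₃); moreover ker M₃ ⊆ ker M₁ ∩ ker M₂, and either ker M₃ = ker M₁ ⊊ ker M₂ or ker M₃ = ker M₂ ⊊ ker M₁. -/

import Mathlib

open Matrix

/-- The `(n+1) × (n+1)` matrix obtained by bordering `M` with the column vector `ρᵀ`,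
the row vector `ρ`, and the scalar `d` in the corner. -/
def border {n : ℕ} (M : Matrix (Fin n) (Fin n) (ZMod 2)) (ρ : Fin n → ZMod 2)
    (d : ZMod 2) : Matrix (Fin n ⊕ Unit) (Fin n ⊕ Unit) (ZMod 2) :=
  fun i j =>
    match i, j with
    | .inl a, .inl b => M a b
    | .inl a, .inr _ => ρ a
    | .inr _, .inl b => ρ b
    | .inr _, .inr _ => d

/-- The nullspace of a square matrix `N`: the space of row vectors `x` with `x · N = 0`. -/
def nsp {m : Type*} [Fintype m] (N : Matrix m m (ZMod 2)) :
    Submodule (ZMod 2) (m → ZMod 2) :=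
  LinearMap.ker N.vecMulLinear

/-- The nullity of a square matrix: the dimension of its nullspace. -/
noncomputable def nullity {m : Type*} [Fintype m] (N : Matrix m m (ZMod 2)) : ℕ :=
  Module.finrank (ZMod 2) (nsp N)

theorem vecMul_border {n : ℕ} (M : Matrix (Fin n) (Fin n) (ZMod 2)) (ρ : Fin n → ZMod 2)
    (d : ZMod 2) (y : Fin n → ZMod 2) (t : ZMod 2) :
    Sum.elim y (fun _ => t) ᵥ* border M ρ d =
      Sum.elim (y ᵥ* M + t • ρ) (fun _ => y ⬝ᵥ ρ + t * d) := by
  ext (i | i) <;> simp [vecMul, dotProduct, border]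

theorem mem_nsp_border {n : ℕ} (M : Matrix (Fin n) (Fin n) (ZMod 2)) (ρ : Fin n → ZMod 2)
    (d : ZMod 2) (y : Fin n → ZMod 2) (t : ZMod 2) :
    Sum.elim y (fun _ => t) ∈ nsp (border M ρ d) ↔
      y ᵥ* M + t • ρ = 0 ∧ y ⬝ᵥ ρ + t * d = 0 := by
  simp [nsp, vecMul_border, funext_iff]

theorem exists_sumElim_unit {α : Type*} {β : Type*} (x : α ⊕ Unit → β) :
    ∃ y t, x = Sum.elim y (fun _ => t) :=
  ⟨x ∘ Sum.inl, x (Sum.inr ()), by ext (i | i) <;> rfl⟩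

theorem vecMul_dotProduct_comm {m : Type*} [Fintype m] {M : Matrix m m (ZMod 2)}
    (hM : M.IsSymm) (y σ : m → ZMod 2) : y ⬝ᵥ (σ ᵥ* M) = (y ᵥ* M) ⬝ᵥ σ := by
  rw [← dotProduct_mulVec, ← vecMul_transpose, hM.eq]

theorem mem_nsp_border_vecMul {n : ℕ} {M : Matrix (Fin n) (Fin n) (ZMod 2)} (hM : M.IsSymm)
    (σ : Fin n → ZMod 2) (d : ZMod 2) (y : Fin n → ZMod 2) (t : ZMod 2) :
    Sum.elim y (fun _ => t) ∈ nsp (border M (σ ᵥ* M) d) ↔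
      (y + t • σ) ᵥ* M = 0 ∧ t * (d - σ ⬝ᵥ (σ ᵥ* M)) = 0 := by
  rw [mem_nsp_border, add_vecMul, smul_vecMul]
  refine and_congr_right fun h => ?_
  have key : y ⬝ᵥ (σ ᵥ* M) + t * (σ ⬝ᵥ (σ ᵥ* M)) = 0 := by
    simpa [vecMul_dotProduct_comm hM, add_dotProduct] using congrArg (· ⬝ᵥ σ) h
  rw [show y ⬝ᵥ (σ ᵥ* M) + t * d = t * (d - σ ⬝ᵥ (σ ᵥ* M)) by linear_combination key]

theorem rank_eq_finrank_range_vecMulLinear {m : Type*} [Fintype m] (N : Matrix m m (ZMod 2)) :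
    N.rank = Module.finrank (ZMod 2) (LinearMap.range N.vecMulLinear) := by
  rw [← rank_transpose, rank, mulVecLin_transpose]

theorem rank_add_nullity {m : Type*} [Fintype m] (N : Matrix m m (ZMod 2)) :
    N.rank + nullity N = Fintype.card m := by
  rw [rank_eq_finrank_range_vecMulLinear, nullity, nsp, LinearMap.finrank_range_add_finrank_ker,
    Module.finrank_fintype_fun_eq_card]

theorem mem_nsp_border_zero_one {n : ℕ} (M : Matrix (Fin n) (Fin n) (ZMod 2))
    (y : Fin n → ZMod 2) (t : ZMod 2) :
    Sum.elim y (fun _ => t) ∈ nsp (border M (fun _ => 0) 1) ↔ y ᵥ* M = 0 ∧ t = 0 := by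
  rw [mem_nsp_border]
  simp [funext_iff, dotProduct]

/-- Extension of a vector by the coordinate `z ⬝ᵥ σ`. -/
def extendByDot {n : ℕ} (σ : Fin n → ZMod 2) :
    (Fin n → ZMod 2) →ₗ[ZMod 2] (Fin n ⊕ Unit → ZMod 2) where
  toFun z := Sum.elim z (fun _ => z ⬝ᵥ σ)
  map_add' y z := by ext (i | i) <;> simp [add_dotProduct]
  map_smul' c z := by ext (i | i) <;> simp

theorem extendByDot_injective {n : ℕ} (σ : Fin n → ZMod 2) :
    Function.Injective (extendByDot σ) := fun _ _ h =>
  funext fun i => congrFun h (Sum.inl i)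

theorem nullity_border_zero_one {n : ℕ} (M : Matrix (Fin n) (Fin n) (ZMod 2)) :
    nullity (border M (fun _ => 0) 1) = nullity M := by
  have h : nsp (border M (fun _ => 0) 1) = (nsp M).map (extendByDot 0) := by
    ext x
    obtain ⟨y, t, rfl⟩ := exists_sumElim_unit x
    rw [mem_nsp_border_zero_one, Submodule.mem_map]
    constructor
    · rintro ⟨hy, rfl⟩
      exact ⟨y, hy, by ext (i | i) <;> simp [extendByDot]⟩
    · rintro ⟨z, hz, h⟩
      obtain rfl : z = y := funext fun i => congrFun h (Sum.inl i)
      exact ⟨hz, by simpa [extendByDot] using (congrFun h (Sum.inr ())).symm⟩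
  rw [nullity, nullity, h]
  exact (Submodule.equivMapOfInjective _ (extendByDot_injective 0) _).finrank_eq.symm

theorem rank_border_zero_one {n : ℕ} (M : Matrix (Fin n) (Fin n) (ZMod 2)) :
    (border M (fun _ => 0) 1).rank = M.rank + 1 := by
  have h₁ := rank_add_nullity (border M (fun _ => 0) 1)
  have h₂ := rank_add_nullity M
  rw [nullity_border_zero_one] at h₁
  simp only [Fintype.card_sum, Fintype.card_unit] at h₁
  omega

theorem vecMul_border_vecMul {n : ℕ} {M : Matrix (Fin n) (Fin n) (ZMod 2)} (hM : M.IsSymm)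
    (σ y : Fin n → ZMod 2) (t : ZMod 2) :
    Sum.elim y (fun _ => t) ᵥ* border M (σ ᵥ* M) (σ ⬝ᵥ (σ ᵥ* M)) =
      extendByDot σ ((y + t • σ) ᵥ* M) := by
  rw [vecMul_border, vecMul_dotProduct_comm hM, vecMul_dotProduct_comm hM, add_vecMul, smul_vecMul]
  simp [extendByDot, add_dotProduct]

theorem rank_border_vecMul {n : ℕ} {M : Matrix (Fin n) (Fin n) (ZMod 2)} (hM : M.IsSymm)
    (σ : Fin n → ZMod 2) :
    (border M (σ ᵥ* M) (σ ⬝ᵥ (σ ᵥ* M))).rank = M.rank := by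
  have h : LinearMap.range (border M (σ ᵥ* M) (σ ⬝ᵥ (σ ᵥ* M))).vecMulLinear =
      (LinearMap.range M.vecMulLinear).map (extendByDot σ) := by
    ext x
    simp only [LinearMap.mem_range, Submodule.mem_map, vecMulLinear_apply]
    constructor
    · rintro ⟨w, rfl⟩
      obtain ⟨y, t, rfl⟩ := exists_sumElim_unit w
      exact ⟨_, ⟨y + t • σ, rfl⟩, (vecMul_border_vecMul hM σ y t).symm⟩
    · rintro ⟨_, ⟨y, rfl⟩, rfl⟩
      exact ⟨Sum.elim y (fun _ => 0), by simp [vecMul_border_vecMul hM]⟩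
  rw [rank_eq_finrank_range_vecMulLinear, rank_eq_finrank_range_vecMulLinear, h]
  exact (Submodule.equivMapOfInjective _ (extendByDot_injective σ) _).finrank_eq.symm

theorem nsp_border_vecMul_of_ne {n : ℕ} {M : Matrix (Fin n) (Fin n) (ZMod 2)} (hM : M.IsSymm)
    (σ : Fin n → ZMod 2) {d : ZMod 2} (hd : d ≠ σ ⬝ᵥ (σ ᵥ* M)) :
    nsp (border M (fun _ => 0) 1) = nsp (border M (σ ᵥ* M) d) := by
  ext x
  obtain ⟨y, t, rfl⟩ := exists_sumElim_unit x
  rw [mem_nsp_border_zero_one, mem_nsp_border_vecMul hM, mul_eq_zero_iff_right (sub_ne_zero.2 hd)]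
  constructor
  · rintro ⟨hy, rfl⟩
    simpa using hy
  · rintro ⟨hy, rfl⟩
    simpa using hy

theorem rank_border_vecMul_of_ne {n : ℕ} {M : Matrix (Fin n) (Fin n) (ZMod 2)} (hM : M.IsSymm)
    (σ : Fin n → ZMod 2) {d : ZMod 2} (hd : d ≠ σ ⬝ᵥ (σ ᵥ* M)) :
    (border M (σ ᵥ* M) d).rank = M.rank + 1 := by
  have h₁ := rank_add_nullity (border M (fun _ => 0) 1)
  have h₂ := rank_add_nullity (border M (σ ᵥ* M) d)
  rw [nullity, nsp_border_vecMul_of_ne hM σ hd, ← nullity, rank_border_zero_one] at h₁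
  omega

theorem nsp_border_zero_one_lt {n : ℕ} {M : Matrix (Fin n) (Fin n) (ZMod 2)} (hM : M.IsSymm)
    (σ : Fin n → ZMod 2) :
    nsp (border M (fun _ => 0) 1) < nsp (border M (σ ᵥ* M) (σ ⬝ᵥ (σ ᵥ* M))) := by
  refine lt_of_le_of_ne (fun x hx => ?_) fun h => ?_
  · obtain ⟨y, t, rfl⟩ := exists_sumElim_unit x
    rw [mem_nsp_border_zero_one] at hx
    obtain ⟨hy, rfl⟩ := hx
    simpa [mem_nsp_border_vecMul hM] using hy
  · have hmem : Sum.elim (-σ) (fun _ => 1) ∈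
        nsp (border M (σ ᵥ* M) (σ ⬝ᵥ (σ ᵥ* M))) := by
      simp [mem_nsp_border_vecMul hM]
    rw [← h, mem_nsp_border_zero_one] at hmem
    exact one_ne_zero hmem.2

/-- **Theorem (Statement 7, Case 2 of the ν,ν,ν+1 lemma).** If `ρ` lies in the row
space of `M`, then one of `M₁, M₂` has rank `rank M` and the other has rank
`rank M + 1 = rank M₃`; moreover `ker M₃ ⊆ ker M₁ ∩ ker M₂`, and either
`ker M₃ = ker M₁ ⊊ ker M₂` or `ker M₃ = ker M₂ ⊊ ker M₁`. -/
theorem nu_lemma_case_two {n : ℕ} (M : Matrix (Fin n) (Fin n) (ZMod 2))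
    (hM : M.IsSymm) (ρ : Fin n → ZMod 2)
    (hρ : ρ ∈ LinearMap.range M.vecMulLinear) :
    ((border M ρ 1).rank = M.rank ∧ (border M ρ 0).rank = M.rank + 1 ∨
      (border M ρ 0).rank = M.rank ∧ (border M ρ 1).rank = M.rank + 1) ∧
    (border M (fun _ => 0) 1).rank = M.rank + 1 ∧
    nsp (border M (fun _ => 0) 1) ≤ nsp (border M ρ 1) ⊓ nsp (border M ρ 0) ∧
    ((nsp (border M (fun _ => 0) 1) = nsp (border M ρ 1) ∧
        nsp (border M ρ 1) < nsp (border M ρ 0)) ∨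
      (nsp (border M (fun _ => 0) 1) = nsp (border M ρ 0) ∧
        nsp (border M ρ 0) < nsp (border M ρ 1))) := by
  obtain ⟨σ, rfl⟩ := hρ
  rw [vecMulLinear_apply]
  have hlt := nsp_border_zero_one_lt hM σ
  have hrank := rank_border_vecMul hM σ
  have hcases : ∀ c : ZMod 2, c = 0 ∨ c = 1 := by decide
  rcases hcases (σ ⬝ᵥ (σ ᵥ* M)) with hc | hc
  · have hd : (1 : ZMod 2) ≠ σ ⬝ᵥ (σ ᵥ* M) := by simp [hc]
    have heq := nsp_border_vecMul_of_ne hM σ hd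
    rw [hc] at hlt hrank
    exact ⟨Or.inr ⟨hrank, rank_border_vecMul_of_ne hM σ hd⟩, rank_border_zero_one M,
      le_inf heq.le hlt.le, Or.inl ⟨heq, heq ▸ hlt⟩⟩
  · have hd : (0 : ZMod 2) ≠ σ ⬝ᵥ (σ ᵥ* M) := by simp [hc]
    have heq := nsp_border_vecMul_of_ne hM σ hd
    rw [hc] at hlt hrank
    exact ⟨Or.inl ⟨hrank, rank_border_vecMul_of_ne hM σ hd⟩, rank_border_zero_one M,
      le_inf hlt.le heq.le, Or.inr ⟨heq, heq ▸ hlt⟩⟩
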